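/- Recursion identity: let S = {a_1 < ... < a_m} with m ≥ 2 and a_j ≤ a_{j+1} − 2 (indices cyclic, with a_{m+1} = a_1 + n). Then A_{k+1}({a_1,...,a_{j−1}, a_j+1, a_{j+1},...,a_m}) − A_{k+1}({a_1,...,a_m}) = Σ_{a_j < b < a_{j+1}−1} A_k({a_1,...,a_{j−1}, a_j, b, a_{j+1}−1,...,a_m−1}) − Σ_{a_{j−1} < b < a_j} A_k({a_1,...,a_{j−1}, b, a_j, a_{j+1}−1,...,a_m−1}). -/

import Mathlib

/-- Two blocks `B`, `B'` form a crossing: there are `i, k ∈ B` and `j, l ∈ B'`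
with `i < j < k < l` or `i > j > k > l`. -/
def Crosses (B B' : Finset ℕ) : Prop :=
  ∃ i ∈ B, ∃ k ∈ B, ∃ j ∈ B', ∃ l ∈ B',
    (i < j ∧ j < k ∧ k < l) ∨ (i > j ∧ j > k ∧ k > l)

/-- `ρ` is a set partition of `{0, ..., n-1}`. -/
def IsPartitionOf (n : ℕ) (ρ : Finset (Finset ℕ)) : Prop :=
  (∀ B ∈ ρ, B.Nonempty) ∧
  (∀ B ∈ ρ, ∀ B' ∈ ρ, B ≠ B' → Disjoint B B') ∧
  ρ.sup id = Finset.range n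

/-- `r` is an orientation of the crossing graph `G(ρ)`: it relates exactly the
pairs of distinct crossing blocks of `ρ`, choosing one direction for each edge. -/
def IsOrientation (ρ : Finset (Finset ℕ)) (r : Finset ℕ → Finset ℕ → Prop) : Prop :=
  (∀ B B', r B B' → B ∈ ρ ∧ B' ∈ ρ ∧ B ≠ B' ∧ Crosses B B') ∧
  (∀ B ∈ ρ, ∀ B' ∈ ρ, B ≠ B' → Crosses B B' → (r B B' ↔ ¬ r B' B))

/-- An orientation is acyclic if it has no directed cycle. -/
def AcyclicRel (r : Finset ℕ → Finset ℕ → Prop) : Prop :=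
  ∀ B, ¬ Relation.TransGen r B B

/-- `r` is a root-connected orientation of `G(ρ)` with root `S`: it is an acyclic
orientation and `S` is its unique source. -/
def RootConnected (ρ : Finset (Finset ℕ)) (r : Finset ℕ → Finset ℕ → Prop)
    (S : Finset ℕ) : Prop :=
  IsOrientation ρ r ∧ AcyclicRel r ∧ S ∈ ρ ∧ (∀ B', ¬ r B' S) ∧
    (∀ B ∈ ρ, (∀ B', ¬ r B' B) → B = S)

/-- `ρ ∈ M_S(n)`: a partition of `{0,...,n-1}` with `S` as a block and all
other blocks of size 2. -/
def MSPartition (n : ℕ) (S : Finset ℕ) (ρ : Finset (Finset ℕ)) : Prop :=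
  IsPartitionOf n ρ ∧ S ∈ ρ ∧ ∀ B ∈ ρ, B ≠ S → B.card = 2

/-- The number of pairs `(ρ, r)` with `ρ ∈ M_S(n)` and `r` a root-connected
orientation of `G(ρ)` with root `S`.  (This is `A_{k+1}(S)` when `n = |S| + 2k`.) -/
noncomputable def countA (n : ℕ) (S : Finset ℕ) : ℕ :=
  Nat.card {p : Finset (Finset ℕ) × (Finset ℕ → Finset ℕ → Prop) //
    MSPartition n S p.1 ∧ RootConnected p.1 p.2 S}

theorem Crosses.symm {A B : Finset ℕ} (h : Crosses A B) : Crosses B A := by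
  obtain ⟨i, hi, k, hk, j, hj, l, hl, h⟩ := h
  rcases h with h | h
  · exact ⟨l, hl, j, hj, k, hk, i, hi, Or.inr ⟨h.2.2, h.2.1, h.1⟩⟩
  · exact ⟨l, hl, j, hj, k, hk, i, hi, Or.inl ⟨h.2.2, h.2.1, h.1⟩⟩

/-- Acyclic orientations of the graph with adjacency relation `E`, all of whose sources
satisfy `P`. -/
def acyclicOrientations {V : Type*} (E : V → V → Prop) (P : V → Prop) : Set (V → V → Prop) :=
  {r | (∀ u v, r u v → E u v) ∧ (∀ u v, E u v → (r u v ↔ ¬ r v u)) ∧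
    (∀ u, ¬ Relation.TransGen r u u) ∧ ∀ u, (∀ v, ¬ r v u) → P u}

/-- Add `none` as a source to a relation on `V`, pointing to the elements satisfying `Q`. -/
def addSource {V : Type*} (Q : V → Prop) (r : V → V → Prop) : Option V → Option V → Prop
  | _, none => False
  | none, some v => Q v
  | some u, some v => r u v

theorem addSource_transGen {V : Type*} {Q : V → Prop} {r : V → V → Prop} {u : V} {y : Option V}
    (h : Relation.TransGen (addSource Q r) (some u) y) :
    ∃ v, y = some v ∧ Relation.TransGen r u v := by
  induction h with
  | @single y h =>
    cases y with
    | none => exact h.elim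
    | some v => exact ⟨v, rfl, .single h⟩
  | @tail y z _ h ih =>
    obtain ⟨v, rfl, hv⟩ := ih
    cases z with
    | none => exact h.elim
    | some w => exact ⟨w, rfl, hv.tail h⟩

theorem addSource_acyclic {V : Type*} {Q : V → Prop} {r : V → V → Prop}
    (h : ∀ u, ¬ Relation.TransGen r u u) (x : Option V) :
    ¬ Relation.TransGen (addSource Q r) x x := by
  intro hx
  cases x with
  | none =>
    obtain ⟨y, -, hy⟩ := Relation.TransGen.tail'_iff.1 hx
    cases y <;> exact hy
  | some u =>
    obtain ⟨v, hv, huv⟩ := addSource_transGen hx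
    cases hv
    exact h _ huv

/-- Deleting a prescribed source is a bijection on acyclic orientations. -/
theorem nonempty_equiv_deleteSource {V : Type*} {E : Option V → Option V → Prop}
    {P : Option V → Prop} (hP : P none) (hE : ∀ x y, E x y → E y x) (hirr : ¬ E none none) :
    Nonempty ({r : Option V → Option V → Prop //
        r ∈ acyclicOrientations E P ∧ ∀ v, ¬ r v none} ≃
      acyclicOrientations (fun u v => E (some u) (some v))
        (fun v => P (some v) ∨ E none (some v))) := by
  refine ⟨⟨fun r => ⟨fun u v => r.1 (some u) (some v), ?_⟩,
    fun r => ⟨addSource (fun v => E none (some v)) r.1, ?_⟩, ?_, ?_⟩⟩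
  · obtain ⟨r, ⟨h1, h2, h3, h4⟩, h5⟩ := r
    refine ⟨fun u v h => h1 _ _ h, fun u v h => h2 _ _ h,
      fun u h => h3 _ (h.lift some fun _ _ h => h), fun u h => ?_⟩
    by_cases hn : r none (some u)
    · exact Or.inr (h1 _ _ hn)
    · refine Or.inl (h4 _ fun v => ?_)
      cases v with
      | none => exact hn
      | some v => exact h v
  · obtain ⟨r, h1, h2, h3, h4⟩ := r
    refine ⟨⟨?_, ?_, addSource_acyclic h3, ?_⟩, fun v h => by cases v <;> exact h⟩
    · rintro (_ | u) (_ | v) h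
      · exact h.elim
      · exact h
      · exact h.elim
      · exact h1 _ _ h
    · rintro (_ | u) (_ | v) h
      · exact (hirr h).elim
      · simpa [addSource] using h
      · simpa [addSource] using hE _ _ h
      · exact h2 _ _ h
    · rintro (_ | u) h
      · exact hP
      · rcases h4 u fun v => h (some v) with h' | h'
        · exact h'
        · exact (h none h').elim
  · rintro ⟨r, ⟨h1, h2, h3, h4⟩, h5⟩
    ext x y
    rcases x with _ | u <;> rcases y with _ | v
    · simpa [addSource] using h5 _
    · simp only [addSource]
      refine ⟨fun h => (h2 _ _ h).2 (h5 _), h1 _ _⟩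
    · simpa [addSource] using h5 _
    · rfl
  · rintro ⟨r, hr⟩
    rfl

/-- A deletion-contraction formula: allowing `none` to be a source. -/
theorem ncard_acyclicOrientations_add {V : Type*} [Finite V] {E : Option V → Option V → Prop}
    {P Q : Option V → Prop} (hE : ∀ x y, E x y → E y x) (hirr : ¬ E none none)
    (hP : P none) (hQ : ¬ Q none) (hPQ : ∀ v, P (some v) ↔ Q (some v)) :
    (acyclicOrientations E P).ncard = (acyclicOrientations E Q).ncard +
      (acyclicOrientations (fun u v => E (some u) (some v))
        (fun v => P (some v) ∨ E none (some v))).ncard := by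
  obtain ⟨e⟩ := nonempty_equiv_deleteSource hP hE hirr
  rw [← Nat.card_coe_set_eq (acyclicOrientations (fun u v => E (some u) (some v)) _),
    ← Nat.card_congr e]
  change _ = _ + Nat.card ↥{r | r ∈ acyclicOrientations E P ∧ ∀ v, ¬ r v none}
  rw [Nat.card_coe_set_eq, ← Set.ncard_union_eq _ (Set.toFinite _) (Set.toFinite _)]
  · congr 1
    ext r
    constructor
    · rintro ⟨h1, h2, h3, h4⟩
      by_cases hn : ∀ v, ¬ r v none
      · exact Or.inr ⟨⟨h1, h2, h3, h4⟩, hn⟩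
      · refine Or.inl ⟨h1, h2, h3, ?_⟩
        rintro (_ | u) h
        · exact (hn h).elim
        · exact (hPQ u).1 (h4 _ h)
    · rintro (⟨h1, h2, h3, h4⟩ | h)
      · refine ⟨h1, h2, h3, ?_⟩
        rintro (_ | u) h
        · exact hP
        · exact (hPQ u).2 (h4 _ h)
      · exact h.1
  · rw [Set.disjoint_left]
    rintro r ⟨_, _, _, h4⟩ ⟨_, h⟩
    exact hQ (h4 _ h)

/-- Root-connected orientations of a crossing graph, transported to a type indexing the blocks. -/
theorem nonempty_equiv_rootConnected {V : Type*} {β : V → Finset ℕ} (hβ : Function.Injective β)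
    {ρ : Finset (Finset ℕ)} (hρ : ∀ B, B ∈ ρ ↔ ∃ v, β v = B) (s : V) :
    Nonempty ({r : Finset ℕ → Finset ℕ → Prop // RootConnected ρ r (β s)} ≃
      {r : V → V → Prop //
        r ∈ acyclicOrientations (fun u v => u ≠ v ∧ Crosses (β u) (β v)) (· = s) ∧
          ∀ v, ¬ r v s}) := by
  have hmem : ∀ v, β v ∈ ρ := fun v => (hρ _).2 ⟨v, rfl⟩
  refine ⟨⟨fun r => ⟨fun u v => r.1 (β u) (β v), ?_⟩,
    fun r => ⟨Relation.Map r.1 β β, ?_⟩, ?_, ?_⟩⟩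
  · obtain ⟨r, ⟨h1, h2⟩, h3, h4, h5, h6⟩ := r
    refine ⟨⟨fun u v h => ⟨fun e => (h1 _ _ h).2.2.1 (congrArg β e), (h1 _ _ h).2.2.2⟩,
      fun u v h => h2 _ (hmem u) _ (hmem v) (hβ.ne h.1) h.2,
      fun u h => h3 _ (h.lift β fun _ _ h => h), fun u h => ?_⟩, fun v => h5 _⟩
    refine hβ (h6 _ (hmem u) fun B hB => ?_)
    obtain ⟨v, rfl⟩ := (hρ B).1 (h1 _ _ hB).1
    exact h v hB
  · obtain ⟨r, ⟨h1, h2, h3, h4⟩, h5⟩ := r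
    have key : ∀ u v, Relation.Map r β β (β u) (β v) ↔ r u v := fun u v =>
      Relation.map_apply_apply hβ hβ r u v
    refine ⟨⟨?_, ?_⟩, ?_, hmem s, ?_, ?_⟩
    · rintro _ _ ⟨u, v, h, rfl, rfl⟩
      exact ⟨hmem u, hmem v, hβ.ne (h1 _ _ h).1, (h1 _ _ h).2⟩
    · intro B hB B' hB' hne hc
      obtain ⟨u, rfl⟩ := (hρ _).1 hB
      obtain ⟨v, rfl⟩ := (hρ _).1 hB'
      rw [key, key]
      exact h2 u v ⟨fun e => hne (congrArg β e), hc⟩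
    · intro B hB
      have : Nonempty V := ⟨s⟩
      refine h3 _ (hB.lift (Function.invFun β) ?_)
      rintro _ _ ⟨u, v, h, rfl, rfl⟩
      rwa [Function.onFun, Function.leftInverse_invFun hβ, Function.leftInverse_invFun hβ]
    · rintro _ ⟨u, v, h, rfl, hv⟩
      rw [hβ hv] at h
      exact h5 _ h
    · intro B hB h
      obtain ⟨u, rfl⟩ := (hρ _).1 hB
      rw [h4 u fun v hv => h _ ((key _ _).2 hv)]
  · rintro ⟨r, ⟨h1, h2⟩, -⟩
    ext B B'
    constructor
    · rintro ⟨u, v, h, rfl, rfl⟩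
      exact h
    · intro h
      obtain ⟨u, rfl⟩ := (hρ _).1 (h1 _ _ h).1
      obtain ⟨v, rfl⟩ := (hρ _).1 (h1 _ _ h).2.1
      exact ⟨u, v, h, rfl, rfl⟩
  · rintro ⟨r, hr⟩
    ext u v
    exact Relation.map_apply_apply hβ hβ r u v

theorem nonempty_equiv_rootConnected_insert {V : Type*} {β : V → Finset ℕ}
    (hβ : Function.Injective β) {τ : Finset (Finset ℕ)} (hτ : ∀ B, B ∈ τ ↔ ∃ v, β v = B)
    {S : Finset ℕ} (hS : S ∉ τ) :
    Nonempty ({r : Finset ℕ → Finset ℕ → Prop // RootConnected (insert S τ) r S} ≃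
      acyclicOrientations (fun u v => u ≠ v ∧ Crosses (β u) (β v)) (fun v => Crosses S (β v))) := by
  have hβ' : Function.Injective (fun x : Option V => x.elim S β) := by
    rintro (_ | u) (_ | v) h
    · rfl
    · exact (hS ((hτ _).2 ⟨v, h.symm⟩)).elim
    · exact (hS ((hτ _).2 ⟨u, h⟩)).elim
    · exact congrArg some (hβ h)
  obtain ⟨e⟩ := nonempty_equiv_rootConnected hβ' (ρ := insert S τ) (fun B => by
    simp only [Finset.mem_insert, hτ, Option.exists, Option.elim, eq_comm (a := B)]) none
  obtain ⟨e'⟩ := nonempty_equiv_deleteSource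
    (E := fun u v : Option V => u ≠ v ∧ Crosses (u.elim S β) (v.elim S β)) (P := (· = none)) rfl
    (fun x y h => ⟨h.1.symm, h.2.symm⟩) (by simp)
  refine ⟨(e.trans e').trans (Equiv.setCongr ?_)⟩
  simp [Option.elim]

/-- `τ` is a partition of `U` into pairs. -/
def IsPairing (U : Finset ℕ) (τ : Finset (Finset ℕ)) : Prop :=
  (∀ B ∈ τ, B.card = 2) ∧ (∀ B ∈ τ, ∀ B' ∈ τ, B ≠ B' → Disjoint B B') ∧ τ.sup id = U

theorem IsPairing.subset {U : Finset ℕ} {τ : Finset (Finset ℕ)} (h : IsPairing U τ)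
    {B : Finset ℕ} (hB : B ∈ τ) : B ⊆ U :=
  h.2.2 ▸ Finset.le_sup (f := id) hB

open Classical in
/-- The partitions of `U` into pairs. -/
noncomputable def pairings (U : Finset ℕ) : Finset (Finset (Finset ℕ)) :=
  U.powerset.powerset.filter (IsPairing U)

theorem mem_pairings {U : Finset ℕ} {τ : Finset (Finset ℕ)} :
    τ ∈ pairings U ↔ IsPairing U τ := by
  simp only [pairings, Finset.mem_filter, Finset.mem_powerset, and_iff_right_iff_imp]
  exact fun h B hB => Finset.mem_powerset.2 (h.subset hB)

/-- The number of root-connected orientations of the crossing graph of `{S} ∪ τ` with root `S`. -/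
noncomputable def rootedCount (S : Finset ℕ) (τ : Finset (Finset ℕ)) : ℕ :=
  Nat.card {r : Finset ℕ → Finset ℕ → Prop // RootConnected (insert S τ) r S}

theorem rootedCount_eq {V : Type*} {β : V → Finset ℕ}
    (hβ : Function.Injective β) {τ : Finset (Finset ℕ)} (hτ : ∀ B, B ∈ τ ↔ ∃ v, β v = B)
    {S : Finset ℕ} (hS : S ∉ τ) :
    rootedCount S τ = (acyclicOrientations (fun u v => u ≠ v ∧ Crosses (β u) (β v))
      (fun v => Crosses S (β v))).ncard := by
  obtain ⟨e⟩ := nonempty_equiv_rootConnected_insert hβ hτ hS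
  rw [rootedCount, Nat.card_congr e, Nat.card_coe_set_eq]

theorem finite_rootConnected {S : Finset ℕ} {τ : Finset (Finset ℕ)} (hS : S ∉ τ) :
    Finite {r : Finset ℕ → Finset ℕ → Prop // RootConnected (insert S τ) r S} := by
  obtain ⟨e⟩ := nonempty_equiv_rootConnected_insert (β := ((↑) : ↥τ → Finset ℕ))
    Subtype.val_injective (by simp) hS
  exact Finite.of_equiv _ e.symm

theorem IsPairing.notMem_of_disjoint {U S : Finset ℕ} {τ : Finset (Finset ℕ)}
    (h : IsPairing U τ) (hS : S.Nonempty) (hd : Disjoint S U) : S ∉ τ := fun hmem =>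
  hS.ne_empty (disjoint_self.1 (hd.mono_right (h.subset hmem)))

theorem IsPairing.insert {U C : Finset ℕ} {τ : Finset (Finset ℕ)}
    (h : IsPairing U τ) (hC : C.card = 2) (hd : Disjoint C U) : IsPairing (C ∪ U) (insert C τ) := by
  refine ⟨?_, ?_, by simp [h.2.2]⟩
  · intro B hB
    rcases Finset.mem_insert.1 hB with rfl | hB
    exacts [hC, h.1 B hB]
  · intro B hB B' hB' hne
    rcases Finset.mem_insert.1 hB with rfl | hτB <;> rcases Finset.mem_insert.1 hB' with rfl | hτB'
    · exact (hne rfl).elim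
    · exact hd.mono_right (h.subset hτB')
    · exact (hd.mono_right (h.subset hτB)).symm
    · exact h.2.1 B hτB B' hτB' hne

theorem sup_erase_eq_sdiff {ρ : Finset (Finset ℕ)} {C : Finset ℕ}
    (hdisj : ∀ B ∈ ρ, ∀ B' ∈ ρ, B ≠ B' → Disjoint B B') (hC : C ∈ ρ) :
    (ρ.erase C).sup id = ρ.sup id \ C := by
  ext x
  simp only [Finset.mem_sup, Finset.mem_erase, id, Finset.mem_sdiff]
  constructor
  · rintro ⟨B, ⟨hne, hB⟩, hx⟩
    exact ⟨⟨B, hB, hx⟩, Finset.disjoint_left.1 (hdisj B hB C hC hne) hx⟩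
  · rintro ⟨⟨B, hB, hx⟩, hxC⟩
    exact ⟨B, ⟨fun e => hxC (e ▸ hx), hB⟩, hx⟩

theorem IsPairing.erase {U C : Finset ℕ} {τ : Finset (Finset ℕ)}
    (h : IsPairing U τ) (hC : C ∈ τ) : IsPairing (U \ C) (τ.erase C) :=
  ⟨fun B hB => h.1 B (Finset.mem_of_mem_erase hB),
    fun B hB B' hB' => h.2.1 B (Finset.mem_of_mem_erase hB) B' (Finset.mem_of_mem_erase hB'),
    by rw [sup_erase_eq_sdiff h.2.1 hC, h.2.2]⟩

theorem msPartition_insert {n : ℕ} {S : Finset ℕ} (hS : S.Nonempty) (hSn : S ⊆ Finset.range n)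
    {τ : Finset (Finset ℕ)} (h : IsPairing (Finset.range n \ S) τ) :
    MSPartition n S (insert S τ) := by
  refine ⟨⟨?_, ?_, ?_⟩, Finset.mem_insert_self _ _, ?_⟩
  · intro B hB
    rcases Finset.mem_insert.1 hB with rfl | hB
    · exact hS
    · exact Finset.card_pos.1 (by rw [h.1 B hB]; norm_num)
  · intro B hB B' hB' hne
    have hd : ∀ B ∈ τ, Disjoint S B := fun B hB =>
      Finset.disjoint_sdiff.mono_right (h.subset hB)
    rcases Finset.mem_insert.1 hB with rfl | hτB <;> rcases Finset.mem_insert.1 hB' with rfl | hτB'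
    · exact (hne rfl).elim
    · exact hd _ hτB'
    · exact (hd _ hτB).symm
    · exact h.2.1 B hτB B' hτB' hne
  · rw [Finset.sup_insert, h.2.2, id, Finset.sup_eq_union, Finset.union_sdiff_of_subset hSn]
  · intro B hB hne
    exact h.1 B (Finset.mem_of_mem_insert_of_ne hB hne)

theorem MSPartition.isPairing_erase {n : ℕ} {S : Finset ℕ} {ρ : Finset (Finset ℕ)}
    (h : MSPartition n S ρ) : IsPairing (Finset.range n \ S) (ρ.erase S) := by
  obtain ⟨⟨-, h1, h2⟩, h3, h4⟩ := h
  refine ⟨fun B hB => h4 B (Finset.mem_of_mem_erase hB) (Finset.ne_of_mem_erase hB),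
    fun B hB B' hB' => h1 B (Finset.mem_of_mem_erase hB) B' (Finset.mem_of_mem_erase hB'), ?_⟩
  rw [sup_erase_eq_sdiff h1 h3, h2]

theorem countA_eq_sum {n : ℕ} {S : Finset ℕ} (hS : S.Nonempty) (hSn : S ⊆ Finset.range n) :
    countA n S = ∑ τ ∈ pairings (Finset.range n \ S), rootedCount S τ := by
  have hnot : ∀ τ : ↥(pairings (Finset.range n \ S)), S ∉ τ.1 := fun τ =>
    (mem_pairings.1 τ.2).notMem_of_disjoint hS Finset.disjoint_sdiff
  let e : {p : Finset (Finset ℕ) × (Finset ℕ → Finset ℕ → Prop) //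
      MSPartition n S p.1 ∧ RootConnected p.1 p.2 S} ≃
      Σ τ : ↥(pairings (Finset.range n \ S)),
        {r : Finset ℕ → Finset ℕ → Prop // RootConnected (insert S τ.1) r S} :=
    { toFun := fun p => ⟨⟨p.1.1.erase S, mem_pairings.2 p.2.1.isPairing_erase⟩,
        ⟨p.1.2, by rw [Finset.insert_erase p.2.1.2.1]; exact p.2.2⟩⟩
      invFun := fun q => ⟨(insert S q.1.1, q.2.1),
        msPartition_insert hS hSn (mem_pairings.1 q.1.2), q.2.2⟩
      left_inv := by
        rintro ⟨⟨ρ, r⟩, h1, h2⟩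
        exact Subtype.ext (Prod.ext (Finset.insert_erase h1.2.1) rfl)
      right_inv := by
        rintro ⟨⟨τ, hτ⟩, r, hr⟩
        have h : (insert S τ).erase S = τ := Finset.erase_insert (hnot ⟨τ, hτ⟩)
        refine Sigma.ext (Subtype.ext h) ?_
        dsimp only
        congr! 2
        rw [h] }
  have := fun τ => finite_rootConnected (hnot τ)
  rw [countA, Nat.card_congr e, Nat.card_sigma]
  exact Finset.sum_coe_sort (pairings _) (rootedCount S)

/-- Sum over the pairings of `U ∪ {q}` by splitting off the pair containing `q`. -/
theorem sum_pairings_insert {M : Type*} [AddCommMonoid M] {U : Finset ℕ} {q : ℕ} (hq : q ∉ U)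
    (f : Finset (Finset ℕ) → M) :
    ∑ τ ∈ pairings (insert q U), f τ =
      ∑ x ∈ U, ∑ τ ∈ pairings (U.erase x), f (insert {x, q} τ) := by
  rw [Finset.sum_sigma']
  symm
  refine Finset.sum_bij (fun p _ => insert {p.1, q} p.2) ?_ ?_ ?_ (fun _ _ => rfl)
  · rintro ⟨x, τ⟩ h
    simp only [Finset.mem_sigma, mem_pairings] at h ⊢
    have hxq : x ≠ q := fun e => hq (e ▸ h.1)
    have := h.2.insert (C := {x, q}) (Finset.card_pair hxq) (by
      simp [Finset.disjoint_left, hq])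
    convert this using 1
    ext y
    simp only [Finset.mem_insert, Finset.mem_union, Finset.mem_singleton, Finset.mem_erase]
    have := h.1
    grind
  · rintro ⟨x, τ⟩ h ⟨y, τ'⟩ h' heq
    simp only [Finset.mem_sigma, mem_pairings] at h h' heq
    have hxq : x ≠ q := fun e => hq (e ▸ h.1)
    have hyq : y ≠ q := fun e => hq (e ▸ h'.1)
    have hn : ∀ {z : ℕ} {σ : Finset (Finset ℕ)} (w : ℕ), IsPairing (U.erase z) σ →
        ({w, q} : Finset ℕ) ∉ σ := fun w hσ hw =>
      hq (Finset.mem_of_mem_erase (hσ.subset hw (by simp)))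
    have hpair : ({x, q} : Finset ℕ) = {y, q} := by
      by_contra hne
      have h1 : ({x, q} : Finset ℕ) ∈ insert {y, q} τ' := heq ▸ Finset.mem_insert_self _ _
      exact hn x h'.2 (Finset.mem_of_mem_insert_of_ne h1 hne)
    have hxy : x = y := by
      have : x ∈ ({y, q} : Finset ℕ) := hpair ▸ Finset.mem_insert_self _ _
      simpa [hxq] using this
    subst hxy
    have : τ = τ' := by
      rw [← Finset.erase_insert (hn x h.2), heq, Finset.erase_insert (hn x h'.2)]
    rw [this]
  · intro τ h
    rw [mem_pairings] at h
    have hqm : q ∈ τ.sup id := h.2.2 ▸ Finset.mem_insert_self _ _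
    obtain ⟨C, hC, hqC⟩ := Finset.mem_sup.1 hqm
    rw [id] at hqC
    obtain ⟨x, hx⟩ : ∃ x, C.erase q = {x} := Finset.card_eq_one.1 (by
      rw [Finset.card_erase_of_mem hqC, h.1 C hC])
    have hxC : x ∈ C.erase q := hx ▸ Finset.mem_singleton_self x
    have hCx : C = {x, q} := by
      rw [← Finset.insert_erase hqC, hx, Finset.pair_comm]
    subst hCx
    have hxU : x ∈ U := Finset.mem_of_mem_insert_of_ne
      (h.subset hC (Finset.mem_of_mem_erase hxC)) (Finset.ne_of_mem_erase hxC)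
    refine ⟨⟨x, τ.erase {x, q}⟩, ?_, Finset.insert_erase hC⟩
    simp only [Finset.mem_sigma, mem_pairings]
    refine ⟨hxU, ?_⟩
    convert h.erase hC using 1
    ext y
    simp only [Finset.mem_insert, Finset.mem_sdiff, Finset.mem_singleton, Finset.mem_erase]
    grind

theorem crosses_pair {A : Finset ℕ} {d e : ℕ} (hde : d < e) :
    Crosses A {d, e} ↔ (∃ a ∈ A, d < a ∧ a < e) ∧ ∃ a ∈ A, a < d ∨ e < a := by
  constructor
  · rintro ⟨i, hi, k, hk, j, hj, l, hl, h⟩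
    simp only [Finset.mem_insert, Finset.mem_singleton] at hj hl
    exact ⟨⟨k, hk, by omega⟩, ⟨i, hi, by omega⟩⟩
  · rintro ⟨⟨k, hk, h1, h2⟩, ⟨i, hi, h | h⟩⟩
    · exact ⟨i, hi, k, hk, d, by simp, e, by simp, Or.inl ⟨h, h1, h2⟩⟩
    · exact ⟨i, hi, k, hk, e, by simp, d, by simp, Or.inr ⟨h, h2, h1⟩⟩

theorem crosses_insert_top {A D : Finset ℕ} {c : ℕ} (hD : D.card = 2) (hc : ∀ d ∈ D, d < c) :
    Crosses (insert c A) D ↔ ∃ a ∈ A, ∃ d ∈ D, ∃ e ∈ D, d < a ∧ a < e := by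
  obtain ⟨d, e, hne, rfl⟩ := Finset.card_eq_two.1 hD
  wlog hde : d < e generalizing d e
  · rw [Finset.pair_comm]
    rw [Finset.pair_comm] at hD hc
    exact this _ _ hne.symm hD hc (by omega)
  have := hc e (by simp)
  rw [crosses_pair hde]
  simp only [Finset.mem_insert, Finset.mem_singleton]
  constructor
  · rintro ⟨⟨a, rfl | ha, h1, h2⟩, -⟩
    · omega
    · exact ⟨a, ha, d, Or.inl rfl, e, Or.inr rfl, h1, h2⟩
  · rintro ⟨a, ha, d', hd', e', he', h1, h2⟩
    exact ⟨⟨a, Or.inr ha, by omega, by omega⟩, c, Or.inl rfl, Or.inr this⟩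

theorem rootedCount_sub {N x : ℕ} {T : Finset ℕ} (hT : T ⊆ Finset.range N) (hTne : T.Nonempty)
    (hx : x ∈ Finset.range N \ T) {τ : Finset (Finset ℕ)}
    (hτ : IsPairing ((Finset.range N \ T).erase x) τ) :
    (rootedCount (insert (N + 1) T) (insert {x, N} τ) : ℤ)
      - rootedCount (insert N T) (insert {x, N + 1} τ) =
    (if ∀ t ∈ T, x < t then (rootedCount (insert x (insert N T)) τ : ℤ) else 0)
      - (if ∀ t ∈ T, t < x then (rootedCount (insert x (insert N T)) τ : ℤ) else 0) := by
  simp only [Finset.mem_sdiff, Finset.mem_range] at hx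
  obtain ⟨hxN, hxT⟩ := hx
  have hTN : ∀ t ∈ T, t < N := fun t ht => Finset.mem_range.1 (hT ht)
  have hlt : ∀ D ∈ τ, ∀ d ∈ D, d < N := fun D hD d hd => Finset.mem_range.1
    (Finset.mem_sdiff.1 (Finset.mem_of_mem_erase (hτ.subset hD hd))).1
  have hnotx : ∀ D ∈ τ, x ∉ D := fun D hD hd =>
    Finset.ne_of_mem_erase (hτ.subset hD hd) rfl
  have hnot : ∀ {q : ℕ} {A : Finset ℕ}, N ≤ q → insert q A ∉ τ := fun hq h =>
    absurd (hlt _ h _ (Finset.mem_insert_self _ _)) (by omega)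
  let β (q : ℕ) (v : Option ↥τ) : Finset ℕ := v.elim {x, q} (↑)
  have hβ : ∀ q, Function.Injective (β q) := by
    rintro q (_ | u) (_ | v) h
    · rfl
    · exact (hnotx _ v.2 ((congrArg (x ∈ ·) h).mp (Finset.mem_insert_self x {q}))).elim
    · exact (hnotx _ u.2 ((congrArg (x ∈ ·) h.symm).mp (Finset.mem_insert_self x {q}))).elim
    · exact congrArg some (Subtype.ext h)
  have hβτ : ∀ q B, B ∈ insert {x, q} τ ↔ ∃ v, β q v = B := fun q B => by
    simp only [Finset.mem_insert, Option.exists, β, Option.elim, Subtype.exists, exists_prop,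
      exists_eq_right, eq_comm (a := B)]
  have hnot' : ∀ {q q' : ℕ}, N ≤ q → q ≠ q' → insert q T ∉ insert {x, q'} τ := by
    intro q q' hq hqq h
    rcases Finset.mem_insert.1 h with h | h
    · have : q ∈ ({x, q'} : Finset ℕ) := h ▸ Finset.mem_insert_self _ _
      simp only [Finset.mem_insert, Finset.mem_singleton] at this
      omega
    · exact hnot hq h
  have htop : ∀ {q : ℕ} {A : Finset ℕ} (v : ↥τ), N ≤ q → (Crosses (insert q A) v ↔
      ∃ a ∈ A, ∃ d ∈ v.1, ∃ e ∈ v.1, d < a ∧ a < e) := fun v hq =>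
    crosses_insert_top (hτ.1 _ v.2) fun d hd => (hlt _ v.2 d hd).trans_le hq
  have hpair : ∀ {q : ℕ} (v : ↥τ), N ≤ q →
      (Crosses {x, q} v ↔ ∃ d ∈ v.1, ∃ e ∈ v.1, d < x ∧ x < e) := fun v hq => by
    rw [Finset.pair_comm, htop v hq]
    simp
  have hE : (fun u v => u ≠ v ∧ Crosses (β N u) (β N v)) =
      (fun u v => u ≠ v ∧ Crosses (β (N + 1) u) (β (N + 1) v)) := by
    have hsymm : ∀ A B, Crosses A B ↔ Crosses B A := fun A B => ⟨.symm, .symm⟩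
    ext u v
    rcases u with _ | u <;> rcases v with _ | v
    · simp
    · simp only [β, Option.elim, hpair v le_rfl, hpair v N.le_succ]
    · simp only [β, Option.elim, hsymm u, hpair u le_rfl, hpair u N.le_succ]
    · rfl
  have hP1 : Crosses (insert (N + 1) T) (β N none) ↔ ∃ t ∈ T, x < t := by
    simp only [β, Option.elim]
    rw [crosses_insert_top (Finset.card_pair hxN.ne) (by simp; omega)]
    simp only [Finset.mem_insert, Finset.mem_singleton]
    constructor
    · rintro ⟨t, ht, d, hd, e, he, h1, h2⟩
      exact ⟨t, ht, by omega⟩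
    · rintro ⟨t, ht, h⟩
      exact ⟨t, ht, x, Or.inl rfl, N, Or.inr rfl, h, hTN t ht⟩
  have hP2 : Crosses (insert N T) (β (N + 1) none) ↔ ∃ t ∈ T, t < x := by
    simp only [β, Option.elim]
    rw [crosses_pair (by omega)]
    simp only [Finset.mem_insert]
    constructor
    · rintro ⟨-, t, rfl | ht, h⟩
      · omega
      · exact ⟨t, ht, by have := hTN t ht; omega⟩
    · rintro ⟨t, ht, h⟩
      exact ⟨⟨N, Or.inl rfl, by omega⟩, t, Or.inr ht, Or.inl h⟩
  have hPs : ∀ v : ↥τ, Crosses (insert (N + 1) T) (β N (some v)) ↔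
      Crosses (insert N T) (β (N + 1) (some v)) := fun v => by
    simp only [β, Option.elim]
    rw [htop v N.le_succ, htop v le_rfl]
  have hF1 := rootedCount_eq (hβ N) (hβτ N) (hnot' (Nat.le_add_right N 1) (by omega))
  have hF2 := rootedCount_eq (hβ (N + 1)) (hβτ (N + 1)) (hnot' (q := N) le_rfl (by omega))
  have hF3 := rootedCount_eq (S := insert x (insert N T)) (β := ((↑) : ↥τ → Finset ℕ))
    Subtype.val_injective (by simp) (fun h => hnotx _ h (Finset.mem_insert_self _ _))
  rw [hE] at hF1
  have hEs : ∀ u v : Option ↥τ, (u ≠ v ∧ Crosses (β (N + 1) u) (β (N + 1) v)) →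
      (v ≠ u ∧ Crosses (β (N + 1) v) (β (N + 1) u)) := fun u v h => ⟨h.1.symm, h.2.symm⟩
  have hmerge : ∀ v : ↥τ, (Crosses (insert N T) v ∨ Crosses {x, N + 1} v) ↔
      Crosses (insert x (insert N T)) v := fun v => by
    rw [Finset.insert_comm, htop v le_rfl, htop v le_rfl, hpair v N.le_succ]
    simp only [Finset.mem_insert, exists_eq_or_imp]
    exact or_comm
  have hne : ∀ t ∈ T, t ≠ x := fun t ht e => hxT (e ▸ ht)
  obtain ⟨t₀, ht₀⟩ := hTne
  by_cases hmin : ∀ t ∈ T, x < t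
  · have hmax : ¬ ∀ t ∈ T, t < x := fun h => (h t₀ ht₀).asymm (hmin t₀ ht₀)
    rw [if_pos hmin, if_neg hmax, hF1, hF2, hF3,
      ncard_acyclicOrientations_add (P := fun v => Crosses (insert (N + 1) T) (β N v))
        (Q := fun v => Crosses (insert N T) (β (N + 1) v)) hEs (by simp) (hP1.2 ⟨t₀, ht₀, hmin t₀ ht₀⟩)
        (fun h => (hP2.1 h).elim fun t ht => ht.2.asymm (hmin t ht.1)) hPs]
    push_cast
    simp only [hPs]
    simp [β, hmerge]
  · by_cases hmax : ∀ t ∈ T, t < x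
    · rw [if_neg hmin, if_pos hmax, hF1, hF2, hF3,
        ncard_acyclicOrientations_add (P := fun v => Crosses (insert N T) (β (N + 1) v))
          (Q := fun v => Crosses (insert (N + 1) T) (β N v)) hEs (by simp) (hP2.2 ⟨t₀, ht₀, hmax t₀ ht₀⟩)
          (fun h => (hP1.1 h).elim fun t ht => ht.2.asymm (hmax t ht.1)) (fun v => (hPs v).symm)]
      push_cast
      simp [β, hmerge]
    · rw [if_neg hmin, if_neg hmax, hF1, hF2, sub_zero, sub_eq_zero]
      push Not at hmin hmax
      obtain ⟨t, ht, h⟩ := hmin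
      obtain ⟨t', ht', h'⟩ := hmax
      congr 3
      ext v
      cases v with
      | none =>
        exact iff_of_true (hP1.2 ⟨t', ht', h'.lt_of_ne (hne t' ht').symm⟩)
          (hP2.2 ⟨t, ht, h.lt_of_ne (hne t ht)⟩)
      | some v => exact hPs v

theorem countA_sub_countA {N : ℕ} {T : Finset ℕ} (hT : T ⊆ Finset.range N) (hTne : T.Nonempty) :
    (countA (N + 2) (insert (N + 1) T) : ℤ) - countA (N + 2) (insert N T) =
      ∑ x ∈ Finset.range N with ∀ t ∈ T, x < t, (countA (N + 1) (insert x (insert N T)) : ℤ)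
      - ∑ x ∈ Finset.range N with ∀ t ∈ T, t < x,
          (countA (N + 1) (insert x (insert N T)) : ℤ) := by
  have hTN : ∀ t ∈ T, t < N := fun t ht => Finset.mem_range.1 (hT ht)
  have hsub : ∀ {q n : ℕ} {A : Finset ℕ}, q < n → A ⊆ Finset.range n →
      insert q A ⊆ Finset.range n := fun hq hA =>
    Finset.insert_subset (Finset.mem_range.2 hq) hA
  have hT' : ∀ {n : ℕ}, N ≤ n → T ⊆ Finset.range n := fun h =>
    hT.trans (Finset.range_mono h)
  have hU1 : Finset.range (N + 2) \ insert (N + 1) T = insert N (Finset.range N \ T) := by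
    ext y
    have := hTN y
    simp only [Finset.mem_sdiff, Finset.mem_range, Finset.mem_insert]
    grind
  have hU2 : Finset.range (N + 2) \ insert N T = insert (N + 1) (Finset.range N \ T) := by
    ext y
    have := hTN y
    simp only [Finset.mem_sdiff, Finset.mem_range, Finset.mem_insert]
    grind
  have hU3 : ∀ x, Finset.range (N + 1) \ insert x (insert N T) =
      (Finset.range N \ T).erase x := by
    intro x
    ext y
    simp only [Finset.mem_sdiff, Finset.mem_range, Finset.mem_insert, Finset.mem_erase]
    grind
  have hc3 : ∀ x ∈ Finset.range N, (countA (N + 1) (insert x (insert N T)) : ℤ) =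
      ∑ τ ∈ pairings ((Finset.range N \ T).erase x),
        (rootedCount (insert x (insert N T)) τ : ℤ) := by
    intro x hx
    rw [countA_eq_sum (Finset.insert_nonempty _ _)
      (hsub (by simp at hx; omega) (hsub (by omega) (hT' (by omega)))), hU3]
    push_cast
    rfl
  have hfilter : ∀ (p : ℕ → Prop) [DecidablePred p], (∀ x ∈ T, ¬ p x) →
      ∑ x ∈ Finset.range N with p x, (countA (N + 1) (insert x (insert N T)) : ℤ) =
      ∑ x ∈ Finset.range N \ T, if p x then (countA (N + 1) (insert x (insert N T)) : ℤ) else 0 := by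
    intro p _ hp
    rw [← Finset.sum_filter]
    refine Finset.sum_congr ?_ fun _ _ => rfl
    ext y
    have := hp y
    simp only [Finset.mem_filter, Finset.mem_sdiff]
    tauto
  rw [countA_eq_sum (Finset.insert_nonempty _ _) (hsub (by omega) (hT' (by omega))),
    countA_eq_sum (Finset.insert_nonempty _ _) (hsub (by omega) (hT' (by omega))), hU1, hU2,
    sum_pairings_insert (by simp), sum_pairings_insert (by simp),
    hfilter (fun x => ∀ t ∈ T, x < t) fun x hx h => lt_irrefl _ (h x hx),
    hfilter (fun x => ∀ t ∈ T, t < x) fun x hx h => lt_irrefl _ (h x hx)]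
  push_cast
  rw [← Finset.sum_sub_distrib, ← Finset.sum_sub_distrib]
  refine Finset.sum_congr rfl fun x hx => ?_
  rw [← Finset.sum_sub_distrib, Finset.sum_congr rfl fun τ hτ =>
    rootedCount_sub hT hTne hx (mem_pairings.1 hτ), Finset.sum_sub_distrib,
    hc3 x (Finset.mem_sdiff.1 hx).1]
  congr 1 <;> split_ifs <;> simp

theorem Crosses.image {n : ℕ} {f : ℕ → ℕ}
    (hf : ∀ i j k l, i < j → j < k → k < l → l < n →
      (f i < f j ∧ f j < f k ∧ f k < f l) ∨ (f j < f k ∧ f k < f l ∧ f l < f i) ∨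
      (f k < f l ∧ f l < f i ∧ f i < f j) ∨ (f l < f i ∧ f i < f j ∧ f j < f k))
    {A B : Finset ℕ} (hA : A ⊆ Finset.range n) (hB : B ⊆ Finset.range n) (h : Crosses A B) :
    Crosses (A.image f) (B.image f) := by
  have key : ∀ {A B : Finset ℕ}, B ⊆ Finset.range n →
      (∃ i ∈ A, ∃ k ∈ A, ∃ j ∈ B, ∃ l ∈ B, i < j ∧ j < k ∧ k < l) →
      Crosses (A.image f) (B.image f) := by
    rintro A B hB ⟨i, hi, k, hk, j, hj, l, hl, hij, hjk, hkl⟩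
    have hm := fun {x : ℕ} {C : Finset ℕ} (hx : x ∈ C) => Finset.mem_image_of_mem f hx
    rcases hf i j k l hij hjk hkl (Finset.mem_range.1 (hB hl)) with h | h | h | h
    · exact ⟨f i, hm hi, f k, hm hk, f j, hm hj, f l, hm hl, Or.inl h⟩
    · exact ⟨f i, hm hi, f k, hm hk, f l, hm hl, f j, hm hj, Or.inr ⟨h.2.2, h.2.1, h.1⟩⟩
    · exact ⟨f k, hm hk, f i, hm hi, f l, hm hl, f j, hm hj, Or.inl h⟩
    · exact ⟨f k, hm hk, f i, hm hi, f j, hm hj, f l, hm hl, Or.inr ⟨h.2.2, h.2.1, h.1⟩⟩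
  obtain ⟨i, hi, k, hk, j, hj, l, hl, h | h⟩ := h
  · exact key hB ⟨i, hi, k, hk, j, hj, l, hl, h⟩
  · exact (key hA ⟨l, hl, j, hj, k, hk, i, hi, h.2.2, h.2.1, h.1⟩).symm

theorem IsPairing.image {U : Finset ℕ} {τ : Finset (Finset ℕ)} (h : IsPairing U τ)
    (σ : Equiv.Perm ℕ) : IsPairing (U.image σ) (τ.image (Finset.image σ)) := by
  refine ⟨?_, ?_, ?_⟩
  · intro B hB
    obtain ⟨C, hC, rfl⟩ := Finset.mem_image.1 hB
    rw [Finset.card_image_of_injective _ σ.injective, h.1 C hC]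
  · intro B hB B' hB' hne
    obtain ⟨C, hC, rfl⟩ := Finset.mem_image.1 hB
    obtain ⟨C', hC', rfl⟩ := Finset.mem_image.1 hB'
    exact (Finset.disjoint_image σ.injective).2
      (h.2.1 C hC C' hC' fun e => hne (congrArg (Finset.image σ) e))
  · rw [← h.2.2]
    ext y
    simp only [Finset.mem_sup, Finset.mem_image, exists_exists_and_eq_and, id]
    constructor
    · rintro ⟨B, hB, x, hx, rfl⟩
      exact ⟨x, ⟨B, hB, hx⟩, rfl⟩
    · rintro ⟨x, ⟨B, hB, hx⟩, rfl⟩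
      exact ⟨B, hB, x, hx, rfl⟩

theorem rootedCount_image {S : Finset ℕ} {τ : Finset (Finset ℕ)} (hS : S ∉ τ)
    (σ : Equiv.Perm ℕ)
    (hσ : ∀ A ∈ insert S τ, ∀ B ∈ insert S τ, Crosses (A.image σ) (B.image σ) ↔ Crosses A B) :
    rootedCount (S.image σ) (τ.image (Finset.image σ)) = rootedCount S τ := by
  have hinj := Finset.image_injective σ.injective
  rw [rootedCount_eq (β := ((↑) : ↥τ → Finset ℕ)) Subtype.val_injective (by simp) hS,
    rootedCount_eq (β := fun v : ↥τ => v.1.image σ) (hinj.comp Subtype.val_injective) (by simp)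
      (by rwa [hinj.mem_finset_image])]
  have hm : ∀ v : ↥τ, v.1 ∈ insert S τ := fun v => Finset.mem_insert_of_mem v.2
  congr 2
  · ext u v
    rw [hσ _ (hm u) _ (hm v)]
  · ext v
    rw [hσ _ (Finset.mem_insert_self _ _) _ (hm v)]

theorem countA_image {n : ℕ} {S : Finset ℕ} (hS : S.Nonempty) (hSn : S ⊆ Finset.range n)
    (σ : Equiv.Perm ℕ) (hn : (Finset.range n).image σ = Finset.range n)
    (hσ : ∀ A B, A ⊆ Finset.range n → B ⊆ Finset.range n →
      (Crosses (A.image σ) (B.image σ) ↔ Crosses A B)) :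
    countA n (S.image σ) = countA n S := by
  rw [countA_eq_sum hS hSn,
    countA_eq_sum (hS.image σ) ((Finset.image_subset_image hSn).trans hn.subset)]
  have hU : Finset.range n \ S.image σ = (Finset.range n \ S).image σ := by
    rw [Finset.image_sdiff _ _ σ.injective, hn]
  have hback : ∀ A : Finset ℕ, (A.image σ).image σ.symm = A := fun A => by
    simp [Finset.image_image]
  have hback' : ∀ A : Finset ℕ, (A.image σ.symm).image σ = A := fun A => by
    simp [Finset.image_image]
  rw [hU]
  symm
  refine Finset.sum_nbij' (fun τ => τ.image (Finset.image σ))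
    (fun τ => τ.image (Finset.image σ.symm)) ?_ ?_ ?_ ?_ ?_
  · intro τ hτ
    exact mem_pairings.2 ((mem_pairings.1 hτ).image σ)
  · intro τ hτ
    have := (mem_pairings.1 hτ).image σ.symm
    rw [hback] at this
    exact mem_pairings.2 this
  · intro τ _
    simp [Finset.image_image, Function.comp_def, hback]
  · intro τ _
    simp [Finset.image_image, Function.comp_def, hback']
  · intro τ hτ
    rw [mem_pairings] at hτ
    have hsub : ∀ A ∈ insert S τ, A ⊆ Finset.range n := by
      intro A hA
      rcases Finset.mem_insert.1 hA with rfl | hA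
      · exact hSn
      · exact (hτ.subset hA).trans Finset.sdiff_subset
    exact (rootedCount_image (hτ.notMem_of_disjoint hS Finset.disjoint_sdiff) σ
      fun A hA B hB => hσ A B (hsub A hA) (hsub B hB)).symm

/-- The rotation of `{0, ..., n-1}` by `c`, extended by the identity. -/
def cyclicShift (n c : ℕ) (hc : c < n) : Equiv.Perm ℕ where
  toFun x := if x < n then if x + c < n then x + c else x + c - n else x
  invFun x := if x < n then if c ≤ x then x - c else x + n - c else x
  left_inv x := by
    dsimp only
    split_ifs <;> omega
  right_inv x := by
    dsimp only
    split_ifs <;> omega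

theorem countA_cyclicShift {n c : ℕ} (hc : c < n) {S : Finset ℕ} (hS : S.Nonempty)
    (hSn : S ⊆ Finset.range n) : countA n (S.image (cyclicShift n c hc)) = countA n S := by
  have hlt : ∀ x < n, cyclicShift n c hc x < n := fun x hx => by
    simp only [cyclicShift, Equiv.coe_fn_mk]
    split_ifs <;> omega
  have hmap : (Finset.range n).image (cyclicShift n c hc) = Finset.range n := by
    refine Finset.eq_of_subset_of_card_le ?_ ?_
    · intro y hy
      obtain ⟨x, hx, rfl⟩ := Finset.mem_image.1 hy
      exact Finset.mem_range.2 (hlt x (Finset.mem_range.1 hx))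
    · rw [Finset.card_image_of_injective _ (Equiv.injective _)]
  refine countA_image hS hSn _ hmap fun A B hA hB => ⟨fun h => ?_, fun h => ?_⟩
  · have := h.image (n := n) (f := (cyclicShift n c hc).symm) ?_
      ((Finset.image_subset_image hA).trans hmap.subset)
      ((Finset.image_subset_image hB).trans hmap.subset)
    · simpa [Finset.image_image] using this
    · intro i j k l hij hjk hkl hl
      simp only [cyclicShift, Equiv.coe_fn_symm_mk]
      split_ifs <;> omega
  · refine h.image (n := n) ?_ hA hB
    intro i j k l hij hjk hkl hl
    simp only [cyclicShift, Equiv.coe_fn_mk]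
    split_ifs <;> omega

theorem countA_image_emod_add {n : ℕ} (hn : 0 < n) {A : Finset ℤ} (hA : A.Nonempty) (d : ℤ) :
    countA n (A.image fun z => ((z + d) % (n : ℤ)).toNat) =
      countA n (A.image fun z => (z % (n : ℤ)).toNat) := by
  have hn' : (0 : ℤ) < n := by exact_mod_cast hn
  have hd0 := Int.emod_nonneg d hn'.ne'
  have hd1 := Int.emod_lt_of_pos d hn'
  rw [← countA_cyclicShift (c := (d % (n : ℤ)).toNat) (by omega)
    (hA.image fun z => (z % (n : ℤ)).toNat), Finset.image_image]
  · congr 1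
    refine Finset.image_congr fun z _ => ?_
    have hz0 := Int.emod_nonneg z hn'.ne'
    have hz1 := Int.emod_lt_of_pos z hn'
    simp only [cyclicShift, Equiv.coe_fn_mk, Function.comp]
    rw [Int.add_emod, if_pos (by omega)]
    split_ifs with h
    · rw [Int.emod_eq_of_lt (by omega) (by omega)]
      omega
    · rw [← Int.sub_emod_right, Int.emod_eq_of_lt (by omega) (by omega)]
      omega
  · intro y hy
    obtain ⟨z, -, rfl⟩ := Finset.mem_image.1 hy
    have hz0 := Int.emod_nonneg z hn'.ne'
    have hz1 := Int.emod_lt_of_pos z hn'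
    rw [Finset.mem_range]
    omega

/-- Recursion identity (Proposition `recursion`): for `S = {a_1 < ... < a_m}` with
cyclic conventions `a_0 = a_m - n`, `a_{m+1} = a_1 + n`, and an index `j` with
`a_j ≤ a_{j+1} - 2`,
`A_{k+1}({a_1,...,a_j+1,...,a_m}) - A_{k+1}({a_1,...,a_m})
  = Σ_{a_j < b < a_{j+1}-1} A_k({a_1,...,a_{j-1},a_j,b,a_{j+1}-1,...,a_m-1})
  - Σ_{a_{j-1} < b < a_j} A_k({a_1,...,a_{j-1},b,a_j,a_{j+1}-1,...,a_m-1})`,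
where both right-hand configurations live on `{0,...,n-2}` (elements taken mod
`n-1` to account for cyclic wrap-around, and mod `n` on the left). -/
theorem countA_recursion (m k n : ℕ) (hm : 2 ≤ m) (hn : n = m + 2 * k)
    (a : ℕ → ℤ) (hmono : StrictMonoOn a (Set.Icc 1 m))
    (h0 : a 0 = a m - n) (htop : a (m + 1) = a 1 + n)
    (h1 : 0 ≤ a 1) (hmn : a m < n)
    (j : ℕ) (hj1 : 1 ≤ j) (hjm : j ≤ m)
    (hgap : a j + 2 ≤ a (j + 1)) :
    (countA n ((Finset.Icc 1 m).image fun i =>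
        (((Function.update a j (a j + 1)) i % (n : ℤ)).toNat)) : ℤ)
      - (countA n ((Finset.Icc 1 m).image fun i => ((a i % (n : ℤ)).toNat)) : ℤ)
    = (∑ b ∈ Finset.Ioo (a j) (a (j + 1) - 1),
        (countA (n - 1)
          (((Finset.Icc 1 m).image fun i =>
              (((if i ≤ j then a i else a i - 1) % ((n : ℤ) - 1)).toNat))
            ∪ {(b % ((n : ℤ) - 1)).toNat}) : ℤ))
      - ∑ b ∈ Finset.Ioo (a (j - 1)) (a j),
        (countA (n - 1)
          (((Finset.Icc 1 m).image fun i =>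
              (((if i ≤ j then a i else a i - 1) % ((n : ℤ) - 1)).toNat))
            ∪ {(b % ((n : ℤ) - 1)).toNat}) : ℤ) := by
  obtain ⟨N, rfl⟩ : ∃ N, n = N + 2 := ⟨n - 2, by omega⟩
  have hmod : ((N + 2 : ℕ) : ℤ) - 1 = ((N + 1 : ℕ) : ℤ) := by push_cast; ring
  rw [hmod]
  change _ = (∑ b ∈ _, (countA (N + 1) _ : ℤ)) - ∑ b ∈ _, (countA (N + 1) _ : ℤ)
  have hle : ∀ {i i' : ℕ}, 1 ≤ i → i ≤ i' → i' ≤ m → a i ≤ a i' := fun h h' h'' =>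
    hmono.monotoneOn ⟨h, h'.trans h''⟩ ⟨h.trans h', h''⟩ h'
  have hlt : ∀ {i i' : ℕ}, 1 ≤ i → i < i' → i' ≤ m → a i < a i' := fun h h' h'' =>
    hmono ⟨h, h'.le.trans h''⟩ ⟨h.trans h'.le, h''⟩ h'
  have hnext : ∀ {i : ℕ}, 1 ≤ i → i < j → a (j + 1) ≤ a i + (N + 2 : ℕ) := by
    intro i hi hij
    have h1i := hle le_rfl hi (by omega)
    rcases hjm.eq_or_lt with rfl | hj
    · omega
    · have := hle (i := j + 1) (by omega) hj le_rfl
      omega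
  have hprev : ∀ {i : ℕ}, j < i → i ≤ m → a i ≤ a (j - 1) + (N + 2 : ℕ) := by
    intro i hij hi
    have him := hle (by omega) hi le_rfl
    rcases hj1.eq_or_lt with rfl | hj
    · rw [Nat.sub_self]
      omega
    · have := hle (i := 1) (i' := j - 1) le_rfl (by omega) (by omega)
      omega
  have hj0 : 0 ≤ a j := h1.trans (hle le_rfl hj1 hjm)
  obtain ⟨d, hd⟩ : ∃ d : ℤ, d = N - a j := ⟨_, rfl⟩
  let v (i : ℕ) : ℤ := if i < j then a i + d else a i + d - (N + 2 : ℕ)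
  have hv : ∀ i ∈ (Finset.Icc 1 m).erase j, 0 ≤ v i ∧ v i < N ∧
      a (j + 1) + d - (N + 2 : ℕ) ≤ v i ∧ v i ≤ a (j - 1) + d := by
    intro i hi
    simp only [Finset.mem_erase, Finset.mem_Icc] at hi
    obtain ⟨hne, hi1, him⟩ := hi
    rcases hne.lt_or_gt with h | h
    · have h2 := hnext hi1 h
      have h3 := hlt hi1 h hjm
      have h4 := hle (i' := j - 1) hi1 (by omega) (by omega)
      simp only [v, if_pos h]
      omega
    · have h2 := hprev h him
      have h3 := hle (i := j + 1) (by omega) h him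
      have h4 := hle hi1 him le_rfl
      simp only [v, if_neg h.not_gt]
      omega
  have hfirst : ∃ i ∈ (Finset.Icc 1 m).erase j, v i = a (j + 1) + d - (N + 2 : ℕ) := by
    rcases hjm.eq_or_lt with rfl | hj
    · refine ⟨1, by simp; omega, ?_⟩
      simp only [v]
      rw [if_pos (by omega), htop]
      ring
    · refine ⟨j + 1, by simp; omega, ?_⟩
      simp only [v]
      rw [if_neg (by omega)]
  have hlast : ∃ i ∈ (Finset.Icc 1 m).erase j, v i = a (j - 1) + d := by
    rcases hj1.eq_or_lt with rfl | hj
    · refine ⟨m, by simp; omega, ?_⟩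
      simp only [v]
      rw [if_neg (by omega), Nat.sub_self, h0]
      ring
    · refine ⟨j - 1, by simp; omega, ?_⟩
      simp only [v]
      rw [if_pos (by omega)]
  have hv2 : ∀ i ∈ (Finset.Icc 1 m).erase j, (a i + d) % ((N + 2 : ℕ) : ℤ) = v i := by
    intro i hi
    obtain ⟨hv0, hvN, -, -⟩ := hv i hi
    simp only [v] at hv0 hvN ⊢
    split_ifs at hv0 hvN ⊢
    · exact Int.emod_eq_of_lt hv0 (by omega)
    · rw [← Int.sub_emod_right, Int.emod_eq_of_lt hv0 (by omega)]
  have hv1 : ∀ i ∈ (Finset.Icc 1 m).erase j,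
      ((if i ≤ j then a i else a i - 1) + d) % ((N + 1 : ℕ) : ℤ) = v i := by
    intro i hi
    obtain ⟨hv0, hvN, -, -⟩ := hv i hi
    have hne := Finset.ne_of_mem_erase hi
    simp only [v] at hv0 hvN ⊢
    split_ifs at hv0 hvN ⊢ with h h' h'
    · exact Int.emod_eq_of_lt hv0 (by omega)
    · omega
    · omega
    · rw [← Int.sub_emod_right, Int.emod_eq_of_lt (by omega) (by omega)]
      push_cast
      ring
  let T : Finset ℕ := ((Finset.Icc 1 m).erase j).image fun i => (v i).toNat
  have hT : T ⊆ Finset.range N := by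
    intro t ht
    obtain ⟨i, hi, rfl⟩ := Finset.mem_image.1 ht
    have := hv i hi
    rw [Finset.mem_range]
    omega
  have hTne : T.Nonempty := by
    obtain ⟨i, hi, -⟩ := hfirst
    exact ⟨_, Finset.mem_image_of_mem _ hi⟩
  have hTmin : ∀ x : ℕ, (∀ t ∈ T, x < t) ↔ (x : ℤ) < a (j + 1) + d - (N + 2 : ℕ) := by
    intro x
    simp only [T, Finset.forall_mem_image]
    constructor
    · intro h
      obtain ⟨i, hi, he⟩ := hfirst
      have := h hi
      omega
    · intro h i hi
      have := hv i hi
      omega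
  have hTmax : ∀ x : ℕ, (∀ t ∈ T, t < x) ↔ a (j - 1) + d < (x : ℤ) := by
    intro x
    simp only [T, Finset.forall_mem_image]
    constructor
    · intro h
      obtain ⟨i, hi, he⟩ := hlast
      have := h hi
      have := hv i hi
      omega
    · intro h i hi
      have := hv i hi
      omega
  have hjmem : j ∈ Finset.Icc 1 m := Finset.mem_Icc.2 ⟨hj1, hjm⟩
  have hIcc : (Finset.Icc 1 m).Nonempty := ⟨j, hjmem⟩
  have himage : ∀ (g : ℕ → ℕ) (q : ℕ), g j = q →
      (∀ i ∈ (Finset.Icc 1 m).erase j, g i = (v i).toNat) →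
      (Finset.Icc 1 m).image g = insert q T := by
    intro g q hq hg
    rw [← Finset.insert_erase hjmem, Finset.image_insert, hq,
      Finset.image_congr hg]
  have hL : ∀ (f : ℕ → ℤ) (q : ℕ), q < N + 2 → f j + d = q →
      (∀ i ∈ (Finset.Icc 1 m).erase j, f i = a i) →
      countA (N + 2) ((Finset.Icc 1 m).image fun i => (f i % ((N + 2 : ℕ) : ℤ)).toNat) =
        countA (N + 2) (insert q T) := by
    intro f q hq hfq hf
    have := countA_image_emod_add (n := N + 2) (by omega) (hIcc.image f) d
    rw [Finset.image_image, Finset.image_image] at this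
    refine this.symm.trans (congrArg _ (himage _ _ ?_ fun i hi => ?_))
    · simp only [Function.comp]
      rw [hfq, Int.emod_eq_of_lt (by omega) (by omega)]
      omega
    · simp only [Function.comp]
      rw [hf i hi, hv2 i hi]
  have hR : ∀ (b : ℤ) (x : ℕ), (b + d) % ((N + 1 : ℕ) : ℤ) = x →
      countA (N + 1) (((Finset.Icc 1 m).image fun i =>
        ((if i ≤ j then a i else a i - 1) % ((N + 1 : ℕ) : ℤ)).toNat)
          ∪ {(b % ((N + 1 : ℕ) : ℤ)).toNat}) = countA (N + 1) (insert x (insert N T)) := by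
    intro b x hx
    have := countA_image_emod_add (n := N + 1) (by omega)
      (A := (Finset.Icc 1 m).image (fun i => if i ≤ j then a i else a i - 1) ∪ {b})
      (by simp) d
    simp only [Finset.image_union, Finset.image_image, Finset.image_singleton] at this
    refine this.symm.trans (congrArg _ ?_)
    rw [himage _ N ?_ fun i hi => ?_, hx, Finset.union_comm, Int.toNat_natCast]
    · rfl
    · simp only [Function.comp, le_refl, if_true, hd]
      rw [add_sub_cancel, Int.emod_eq_of_lt (by omega) (by omega)]
      omega
    · simp only [Function.comp]
      rw [hv1 i hi]
  rw [hL (Function.update a j (a j + 1)) (N + 1) (by omega) (by simp; omega)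
      (fun i hi => Function.update_of_ne (Finset.ne_of_mem_erase hi) _ _),
    hL a N (by omega) (by omega) (fun _ _ => rfl), countA_sub_countA hT hTne]
  congr 1
  · symm
    refine Finset.sum_bij' (fun b _ => (b + d - (N + 1 : ℕ)).toNat)
      (fun x _ => (x : ℤ) - d + (N + 1 : ℕ)) ?_ ?_ ?_ ?_ ?_
    · intro b hb
      obtain ⟨i, hi, he⟩ := hfirst
      have := hv i hi
      rw [Finset.mem_Ioo] at hb
      rw [Finset.mem_filter, hTmin, Finset.mem_range]
      omega
    · intro x hx
      rw [Finset.mem_filter, hTmin, Finset.mem_range] at hx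
      rw [Finset.mem_Ioo]
      omega
    · intro b hb
      rw [Finset.mem_Ioo] at hb
      omega
    · intro x hx
      omega
    · intro b hb
      obtain ⟨i, hi, he⟩ := hfirst
      have := hv i hi
      rw [Finset.mem_Ioo] at hb
      rw [hR b (b + d - (N + 1 : ℕ)).toNat]
      rw [← Int.sub_emod_right, Int.emod_eq_of_lt (by omega) (by omega)]
      omega
  · symm
    refine Finset.sum_bij' (fun b _ => (b + d).toNat) (fun x _ => (x : ℤ) - d) ?_ ?_ ?_ ?_ ?_
    · intro b hb
      obtain ⟨i, hi, he⟩ := hlast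
      have := hv i hi
      rw [Finset.mem_Ioo] at hb
      rw [Finset.mem_filter, hTmax, Finset.mem_range]
      omega
    · intro x hx
      rw [Finset.mem_filter, hTmax, Finset.mem_range] at hx
      rw [Finset.mem_Ioo]
      omega
    · intro b hb
      obtain ⟨i, hi, he⟩ := hlast
      have := hv i hi
      rw [Finset.mem_Ioo] at hb
      omega
    · intro x hx
      omega
    · intro b hb
      obtain ⟨i, hi, he⟩ := hlast
      have := hv i hi
      rw [Finset.mem_Ioo] at hb
      rw [hR b (b + d).toNat]
      rw [Int.emod_eq_of_lt (by omega) (by omega)]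
      omega
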